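/- (The Steiner conic) Let A, B, C, D, E, F be six distinct points of ℙ²(ℂ) on an irreducible conic, no three collinear. Let p₁ be the generalized Pascal line of the reducible cubics l(AB)·l(DF)·l(CE) and l(AC)·l(EF)·l(BD); p₂ of l(AC)·l(BF)·l(DE) and l(AE)·l(BC)·l(DF); p₄ of l(AB)·l(DE)·l(CF) and l(AF)·l(BE)·l(CD); q₁ of l(AB)·l(DF)·l(CE) and l(AE)·l(BF)·l(CD); q₂ of l(AC)·l(BF)·l(DE) and l(AF)·l(BD)·l(CE); q₄ of l(AB)·l(DE)·l(CF) and l(AD)·l(BC)·l(EF), assuming each of these six pairs of cubics satisfies the hypotheses for a generalized Pascal line and that the lines pᵢ and qⱼ are pairwise distinct for i, j ∈ {1,2,4}. Then the six points p₁ ∩ q₂, p₁ ∩ q₄, p₂ ∩ q₁, p₂ ∩ q₄, p₄ ∩ q₁ and p₄ ∩ q₂ lie on a common conic, i.e. some nonzero homogeneous polynomial of degree 2 vanishes at all six points. -/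

import Mathlib

open MvPolynomial

noncomputable section

/-- Polynomials in three variables over `ℂ`. -/
abbrev Poly3 : Type := MvPolynomial (Fin 3) ℂ

/-- The complex projective plane `ℙ²(ℂ)`, the projectivization of `ℂ³`. -/
abbrev ProjPlane : Type := Projectivization ℂ (Fin 3 → ℂ)

/-- A (homogeneous) polynomial vanishes at a projective point if it vanishes at its
canonical nonzero representative vector (for homogeneous polynomials this is equivalent
to vanishing at any nonzero representative vector). -/
def VanishesAt (F : Poly3) (p : ProjPlane) : Prop :=
  MvPolynomial.eval p.rep F = 0

/-- The set of points of `ℙ²(ℂ)` at which `F` vanishes. -/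
def zeroSet (F : Poly3) : Set ProjPlane := {p | VanishesAt F p}

/-- Two defining polynomials give the same curve iff they are proportional by a
nonzero scalar. -/
def ProportionalTo (F G : Poly3) : Prop := ∃ c : ℂ, c ≠ 0 ∧ G = c • F

/-- A set of points is collinear if some nonzero homogeneous polynomial of degree 1
vanishes at all of them. -/
def Collin (s : Set ProjPlane) : Prop :=
  ∃ L : Poly3, L ≠ 0 ∧ L.IsHomogeneous 1 ∧ ∀ p ∈ s, VanishesAt L p

/-- No three distinct points of `s` are collinear. -/
def NoThreeCollinear (s : Set ProjPlane) : Prop :=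
  ∀ p q r, p ∈ s → q ∈ s → r ∈ s → p ≠ q → p ≠ r → q ≠ r → ¬ Collin {p, q, r}

/-- `L` is a (the) line through the points `p` and `q`. -/
def IsLineThrough (L : Poly3) (p q : ProjPlane) : Prop :=
  L ≠ 0 ∧ L.IsHomogeneous 1 ∧ VanishesAt L p ∧ VanishesAt L q

/-- `L` is the generalized Pascal line of the cubics `D₁` and `D₂` with respect to six
points `A, …, F`: the cubics have no common nonconstant factor, their common zero set
consists of exactly nine distinct points (the six given ones plus three further points),
and `L` is the line through the three further intersection points. -/
def IsGenPascalLine (A B C D E F : ProjPlane) (D₁ D₂ L : Poly3) : Prop :=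
  IsRelPrime D₁ D₂ ∧ L ≠ 0 ∧ L.IsHomogeneous 1 ∧
    ∃ P Q R : ProjPlane,
      ([A, B, C, D, E, F, P, Q, R] : List ProjPlane).Pairwise (· ≠ ·) ∧
      zeroSet D₁ ∩ zeroSet D₂ = {A, B, C, D, E, F, P, Q, R} ∧
      VanishesAt L P ∧ VanishesAt L Q ∧ VanishesAt L R

open Matrix

/-! ### Linear forms and lines -/

theorem exists_eval_eq_dotProduct {L : Poly3} (hL : L.IsHomogeneous 1) :
    ∃ w : Fin 3 → ℂ, ∀ v, eval v L = w ⬝ᵥ v := by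
  have hmem : L ∈ homogeneousSubmodule (Fin 3) ℂ 1 := hL
  rw [homogeneousSubmodule_one_eq_span_X] at hmem
  clear hL
  induction hmem using Submodule.span_induction with
  | mem p hp =>
    obtain ⟨i, rfl⟩ := hp
    exact ⟨Pi.single i 1, fun v => by simp⟩
  | zero => exact ⟨0, fun v => by simp⟩
  | add p q _ _ hp hq =>
    obtain ⟨w, hw⟩ := hp
    obtain ⟨w', hw'⟩ := hq
    exact ⟨w + w', fun v => by simp [hw, hw']⟩
  | smul c p _ hp =>
    obtain ⟨w, hw⟩ := hp
    exact ⟨c • w, fun v => by simp [hw]⟩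

theorem linearIndependent_rep {P Q : ProjPlane} (h : P ≠ Q) :
    LinearIndependent ℂ ![P.rep, Q.rep] := by
  rw [LinearIndependent.pair_iff' P.rep_nonzero]
  intro c hc
  apply h
  rw [← P.mk_rep, ← Q.mk_rep, eq_comm, Projectivization.mk_eq_mk_iff']
  exact ⟨c, hc⟩

theorem IsLineThrough.symm {L : Poly3} {P Q : ProjPlane} (h : IsLineThrough L P Q) :
    IsLineThrough L Q P :=
  ⟨h.1, h.2.1, h.2.2.2, h.2.2.1⟩

/-- Two lines through the same pair of distinct points are proportional. -/
theorem IsLineThrough.exists_eq_C_mul {L L' : Poly3} {P Q : ProjPlane}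
    (h : IsLineThrough L P Q) (h' : IsLineThrough L' P Q) (hPQ : P ≠ Q) :
    ∃ c : ℂ, c ≠ 0 ∧ L = C c * L' := by
  have hn := crossProduct_ne_zero_iff_linearIndependent.2 (linearIndependent_rep hPQ)
  have key : ∀ {M : Poly3}, IsLineThrough M P Q →
      ∃ c : ℂ, c ≠ 0 ∧ ∀ v, eval v M = c * (crossProduct P.rep Q.rep ⬝ᵥ v) := by
    rintro M ⟨hM0, hM, hMP, hMQ⟩
    obtain ⟨w, hw⟩ := exists_eval_eq_dotProduct hM
    rw [VanishesAt, hw] at hMP hMQ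
    have hcross : crossProduct (crossProduct P.rep Q.rep) w = 0 := by
      rw [cross_cross_eq_smul_sub_smul, dotProduct_comm, hMP, dotProduct_comm, hMQ]
      simp
    have hdep : ¬ LinearIndependent ℂ ![crossProduct P.rep Q.rep, w] := fun h =>
      crossProduct_ne_zero_iff_linearIndependent.2 h hcross
    rw [LinearIndependent.pair_iff' hn] at hdep
    push Not at hdep
    obtain ⟨c, rfl⟩ := hdep
    have hev : ∀ v, eval v M = c * (crossProduct P.rep Q.rep ⬝ᵥ v) := fun v => by
      rw [hw, smul_dotProduct, smul_eq_mul]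
    refine ⟨c, ?_, hev⟩
    rintro rfl
    exact hM0 (MvPolynomial.funext fun v => by simp [hev])
  obtain ⟨c, hc, hcL⟩ := key h
  obtain ⟨d, hd, hdL⟩ := key h'
  refine ⟨c / d, div_ne_zero hc hd, MvPolynomial.funext fun v => ?_⟩
  rw [hcL, map_mul, eval_C, hdL]
  field_simp

theorem vanishesAt_mul {F G : Poly3} {P : ProjPlane} :
    VanishesAt (F * G) P ↔ VanishesAt F P ∨ VanishesAt G P := by
  simp [VanishesAt]

theorem vanishesAt_C_mul {F : Poly3} {c : ℂ} {P : ProjPlane} (hc : c ≠ 0) :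
    VanishesAt (C c * F) P ↔ VanishesAt F P := by
  simp [VanishesAt, hc]

theorem IsLineThrough.C_mul {L : Poly3} {P Q : ProjPlane} {c : ℂ} (h : IsLineThrough L P Q)
    (hc : c ≠ 0) : IsLineThrough (C c * L) P Q :=
  ⟨mul_ne_zero (C_ne_zero.2 hc) h.1, h.2.1.C_mul c, (vanishesAt_C_mul hc).2 h.2.2.1,
    (vanishesAt_C_mul hc).2 h.2.2.2⟩

/-- A line through two vertices of a triangle misses the third one. -/
theorem IsLineThrough.not_vanishesAt {L : Poly3} {P Q R : ProjPlane}
    (h : IsLineThrough L P Q) (hn : ¬ Collin {P, Q, R}) : ¬ VanishesAt L R := by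
  intro hR
  refine hn ⟨L, h.1, h.2.1, ?_⟩
  rintro p (rfl | rfl | rfl)
  exacts [h.2.2.1, h.2.2.2, hR]

/-- Two sides of a triangle meet only at their common vertex. -/
theorem IsLineThrough.eq_of_vanishesAt {l m : Poly3} {P Q R S : ProjPlane}
    (hl : IsLineThrough l P Q) (hm : IsLineThrough m P R) (hn : ¬ Collin {P, Q, R})
    (hlS : VanishesAt l S) (hmS : VanishesAt m S) : S = P := by
  by_contra hne
  obtain ⟨c, -, rfl⟩ := IsLineThrough.exists_eq_C_mul
    ⟨hl.1, hl.2.1, hl.2.2.1, hlS⟩ ⟨hm.1, hm.2.1, hm.2.2.1, hmS⟩ (Ne.symm hne)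
  refine hl.not_vanishesAt hn ?_
  rw [vanishesAt_mul]
  exact Or.inr hm.2.2.2

/-- A conic congruent to a multiple of the product of the sides `PR`, `QR` modulo the side `PQ`
meets the side `PQ` only at `P` and `Q`. -/
theorem IsLineThrough.eq_or_eq_of_conic {K l m n r : Poly3} {P Q R S : ProjPlane} {c s : ℂ}
    (hl : IsLineThrough l P Q) (hm : IsLineThrough m P R) (hn : IsLineThrough n Q R)
    (hPQR : ¬ Collin {P, Q, R}) (hs : s ≠ 0) (hK : C c * K = r * l + C s * (m * n))
    (hlS : VanishesAt l S) (hKS : VanishesAt K S) : S = P ∨ S = Q := by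
  have h := congrArg (eval S.rep) hK
  simp only [VanishesAt] at hlS hKS
  simp only [map_mul, map_add, eval_C, hlS, hKS, mul_zero, zero_add] at h
  rcases mul_eq_zero.1 ((mul_eq_zero.1 h.symm).resolve_left hs) with h | h
  · exact Or.inl (hl.eq_of_vanishesAt hm hPQR hlS h)
  · refine Or.inr (hl.symm.eq_of_vanishesAt hn ?_ hlS h)
    rwa [Set.insert_comm]

/-! ### Generalized Pascal lines -/

/-- If `D₁ - D₂`, suitably normalized, is the product of `π` and a conic meeting `D₁` only at the
six given points, then `π` is the generalized Pascal line. -/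
theorem IsGenPascalLine.exists_eq_C_mul {A B C' D E F : ProjPlane} {D₁ D₂ L M₁ M₂ π K : Poly3}
    {c₁ c₂ : ℂ} (h : IsGenPascalLine A B C' D E F D₁ D₂ L) (hc₁ : c₁ ≠ 0) (hc₂ : c₂ ≠ 0)
    (h₁ : D₁ = C c₁ * M₁) (h₂ : D₂ = C c₂ * M₂) (hπ : π.IsHomogeneous 1)
    (hM : M₁ - M₂ = π * K)
    (hK : ∀ P, VanishesAt M₁ P → VanishesAt K P →
      P = A ∨ P = B ∨ P = C' ∨ P = D ∨ P = E ∨ P = F) :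
    ∃ c : ℂ, c ≠ 0 ∧ L = C c * π := by
  obtain ⟨hrel, hL0, hL, P, Q, R, hdist, hzero, hP, hQ, -⟩ := h
  have hvan : ∀ {S}, S ∈ zeroSet D₁ ∩ zeroSet D₂ → VanishesAt M₁ S ∧ VanishesAt M₂ S := by
    rintro S ⟨hS₁, hS₂⟩
    rw [zeroSet, Set.mem_ofPred_eq] at hS₁ hS₂
    rw [h₁, vanishesAt_C_mul hc₁] at hS₁
    rw [h₂, vanishesAt_C_mul hc₂] at hS₂
    exact ⟨hS₁, hS₂⟩
  have hπS : ∀ {S}, S ∈ zeroSet D₁ ∩ zeroSet D₂ →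
      ¬ (S = A ∨ S = B ∨ S = C' ∨ S = D ∨ S = E ∨ S = F) → VanishesAt π S := by
    intro S hS hne
    obtain ⟨hS₁, hS₂⟩ := hvan hS
    have := congrArg (eval S.rep) hM
    rw [map_sub, hS₁, hS₂, sub_zero, map_mul, eq_comm, mul_eq_zero] at this
    exact this.resolve_right fun h => hne (hK S hS₁ h)
  have hπ0 : π ≠ 0 := by
    rintro rfl
    rw [zero_mul, sub_eq_zero] at hM
    have hdvd : D₂ ∣ D₁ := ⟨C (c₁ / c₂), by
      rw [h₁, h₂, hM, mul_right_comm, ← C_mul, mul_div_cancel₀ _ hc₂]⟩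
    have hunit : IsUnit D₂ := hrel hdvd dvd_rfl
    have hA : A ∈ zeroSet D₁ ∩ zeroSet D₂ := by rw [hzero]; simp
    exact (hunit.map (eval A.rep)).ne_zero hA.2
  simp only [List.pairwise_cons, List.mem_cons, List.not_mem_nil, or_false, forall_eq_or_imp,
    forall_eq] at hdist
  refine IsLineThrough.exists_eq_C_mul ⟨hL0, hL, hP, hQ⟩
    ⟨hπ0, hπ, hπS (by rw [hzero]; simp) ?_, hπS (by rw [hzero]; simp) ?_⟩ (by tauto)
  all_goals
    rintro (rfl | rfl | rfl | rfl | rfl | rfl) <;> tauto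

/-! ### The converse of Pascal's theorem -/

theorem prime_of_isHomogeneous_one {L : Poly3} (hL : L.IsHomogeneous 1) (hL0 : L ≠ 0) :
    Prime L := by
  refine (irreducible_of_totalDegree_eq_one (hL.totalDegree hL0) fun c hc => ?_).prime
  obtain ⟨d, hd⟩ := MvPolynomial.ne_zero_iff.1 hL0
  refine isUnit_iff_ne_zero.2 ?_
  rintro rfl
  exact hd (zero_dvd_iff.1 (hc d))

theorem exists_eq_C_mul_of_dvd {L M : Poly3} (hL : L.IsHomogeneous 1) (hM : M.IsHomogeneous 1)
    (hM0 : M ≠ 0) (h : L ∣ M) : ∃ c : ℂ, c ≠ 0 ∧ M = C c * L := by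
  obtain ⟨r, rfl⟩ := h
  have hL0 := left_ne_zero_of_mul hM0
  have hr0 := right_ne_zero_of_mul hM0
  have hdeg := totalDegree_mul_of_isDomain hL0 hr0
  rw [hL.totalDegree hL0, hM.totalDegree hM0] at hdeg
  have hr := totalDegree_eq_zero_iff_eq_C.1 (show r.totalDegree = 0 by lia)
  refine ⟨r.coeff 0, ?_, by rw [← hr, mul_comm]⟩
  intro h0
  rw [h0, C_0] at hr
  exact hr0 hr

/-- If the three intersections of opposite sides of a hexagon are collinear, then the vertices of
the hexagon lie on a conic. Here the line `m` through `pᵢ ∩ qᵢ` is given by expressing it in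
terms of `pᵢ` and `qᵢ`. -/
theorem exists_conic_of_eq_add {p₁ p₂ p₄ q₁ q₂ q₄ m : Poly3} {a₁ a₂ a₄ b₁ b₂ b₄ : ℂ}
    (hp₁ : p₁.IsHomogeneous 1) (hp₂ : p₂.IsHomogeneous 1) (hp₄ : p₄.IsHomogeneous 1)
    (hq₁ : q₁.IsHomogeneous 1) (hq₂ : q₂.IsHomogeneous 1) (hq₄ : q₄.IsHomogeneous 1)
    (hp₁0 : p₁ ≠ 0) (hp₂0 : p₂ ≠ 0) (hp₄0 : p₄ ≠ 0)
    (hq₁0 : q₁ ≠ 0) (hq₂0 : q₂ ≠ 0) (hq₄0 : q₄ ≠ 0)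
    (hne : ∀ i j : Fin 3, ¬ ProportionalTo (![p₁, p₂, p₄] i) (![q₁, q₂, q₄] j))
    (hm : m.IsHomogeneous 1) (hm0 : m ≠ 0) (h₁ : m = C a₁ * p₁ + C b₁ * q₁)
    (h₂ : m = C a₂ * p₂ + C b₂ * q₂) (h₄ : m = C a₄ * p₄ + C b₄ * q₄)
    {X₁₂ X₁₄ X₂₁ X₂₄ X₄₁ X₄₂ : ProjPlane}
    (hX₁₂ : VanishesAt p₁ X₁₂ ∧ VanishesAt q₂ X₁₂)
    (hX₁₄ : VanishesAt p₁ X₁₄ ∧ VanishesAt q₄ X₁₄)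
    (hX₂₁ : VanishesAt p₂ X₂₁ ∧ VanishesAt q₁ X₂₁)
    (hX₂₄ : VanishesAt p₂ X₂₄ ∧ VanishesAt q₄ X₂₄)
    (hX₄₁ : VanishesAt p₄ X₄₁ ∧ VanishesAt q₁ X₄₁)
    (hX₄₂ : VanishesAt p₄ X₄₂ ∧ VanishesAt q₂ X₄₂) :
    ∃ S : Poly3, S ≠ 0 ∧ S.IsHomogeneous 2 ∧
      ∀ p ∈ [X₁₂, X₁₄, X₂₁, X₂₄, X₄₁, X₄₂], VanishesAt S p := by
  have hdvd : ∀ i j : Fin 3, ¬ (![p₁, p₂, p₄] i ∣ ![q₁, q₂, q₄] j) := by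
    intro i j h
    obtain ⟨c, hc, hcq⟩ := exists_eq_C_mul_of_dvd (by fin_cases i <;> assumption)
      (by fin_cases j <;> assumption) (by fin_cases j <;> assumption) h
    exact hne i j ⟨c, hc, by rw [hcq, C_mul']⟩
  have hC : ∀ (i j : Fin 3) (a b : ℂ), m = C a * ![q₁, q₂, q₄] j → m ≠ C b * ![p₁, p₂, p₄] i := by
    intro i j a b ha hb
    have ha0 : a ≠ 0 := by rintro rfl; exact hm0 (by simp [ha])
    refine hdvd i j ⟨C (b / a), ?_⟩
    apply mul_left_cancel₀ (C_ne_zero.2 ha0)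
    rw [← ha, hb, mul_left_comm, ← C_mul, mul_div_cancel₀ _ ha0, mul_comm]
  refine ⟨m ^ 2 - m * (C a₁ * p₁ + C a₂ * p₂ + C a₄ * p₄) +
    ((C a₁ * p₁) * (C a₂ * p₂) + (C a₁ * p₁) * (C a₄ * p₄) + (C a₂ * p₂) * (C a₄ * p₄)),
    ?_, ?_, ?_⟩
  · intro hS
    have hprod : C (a₁ * a₂ * a₄) * (p₁ * p₂ * p₄) + C (b₁ * b₂ * b₄) * (q₁ * q₂ * q₄) = 0 := by
      have e₁ : C b₁ * q₁ = m - C a₁ * p₁ := by rw [h₁]; ring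
      have e₂ : C b₂ * q₂ = m - C a₂ * p₂ := by rw [h₂]; ring
      have e₄ : C b₄ * q₄ = m - C a₄ * p₄ := by rw [h₄]; ring
      calc _ = (C a₁ * p₁) * (C a₂ * p₂) * (C a₄ * p₄) +
            (C b₁ * q₁) * (C b₂ * q₂) * (C b₄ * q₄) := by simp only [map_mul]; ring
        _ = m * (m ^ 2 - m * (C a₁ * p₁ + C a₂ * p₂ + C a₄ * p₄) +
            ((C a₁ * p₁) * (C a₂ * p₂) + (C a₁ * p₁) * (C a₄ * p₄) +
              (C a₂ * p₂) * (C a₄ * p₄))) := by rw [e₁, e₂, e₄]; ring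
        _ = 0 := by rw [hS, mul_zero]
    have hb : b₁ * b₂ * b₄ = 0 := by
      by_contra hb
      have hprime := prime_of_isHomogeneous_one hp₁ hp₁0
      have h : p₁ ∣ C (b₁ * b₂ * b₄) * (q₁ * q₂ * q₄) := by
        have h' : p₁ ∣ C (a₁ * a₂ * a₄) * (p₁ * p₂ * p₄) :=
          ⟨C (a₁ * a₂ * a₄) * (p₂ * p₄), by ring⟩
        rw [← dvd_add_right h', hprod]
        exact dvd_zero _
      rcases hprime.dvd_or_dvd h with h | h
      · exact hprime.not_isUnit
          (isUnit_of_dvd_unit h ((isUnit_iff_ne_zero.2 hb).map C))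
      · rcases hprime.dvd_or_dvd h with h | h
        · rcases hprime.dvd_or_dvd h with h | h
          · exact hdvd 0 0 h
          · exact hdvd 0 1 h
        · exact hdvd 0 2 h
    have ha : a₁ * a₂ * a₄ = 0 := by
      simpa [hb, hp₁0, hp₂0, hp₄0, or_assoc] using hprod
    simp only [mul_eq_zero] at ha hb
    have hq : ∃ (j : Fin 3) (a : ℂ), m = C a * ![q₁, q₂, q₄] j := by
      rcases ha with (rfl | rfl) | rfl
      exacts [⟨0, b₁, by simp [h₁]⟩, ⟨1, b₂, by simp [h₂]⟩, ⟨2, b₄, by simp [h₄]⟩]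
    have hp : ∃ (i : Fin 3) (a : ℂ), m = C a * ![p₁, p₂, p₄] i := by
      rcases hb with (rfl | rfl) | rfl
      exacts [⟨0, a₁, by simp [h₁]⟩, ⟨1, a₂, by simp [h₂]⟩, ⟨2, a₄, by simp [h₄]⟩]
    obtain ⟨j, a, hj⟩ := hq
    obtain ⟨i, b, hi⟩ := hp
    exact hC i j a b hj hi
  · have hP₁ := hp₁.C_mul a₁
    have hP₂ := hp₂.C_mul a₂
    have hP₄ := hp₄.C_mul a₄
    exact ((hm.pow 2).sub (hm.mul ((hP₁.add hP₂).add hP₄))).add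
      (((hP₁.mul hP₂).add (hP₁.mul hP₄)).add (hP₂.mul hP₄))
  · have e₁ := fun v => congrArg (eval v) h₁
    have e₂ := fun v => congrArg (eval v) h₂
    have e₄ := fun v => congrArg (eval v) h₄
    simp only [map_add, map_mul, eval_C] at e₁ e₂ e₄
    simp only [VanishesAt] at hX₁₂ hX₁₄ hX₂₁ hX₂₄ hX₄₁ hX₄₂ ⊢
    simp only [List.forall_mem_cons, map_add, map_sub, map_mul, map_pow, eval_C]
    refine ⟨?_, ?_, ?_, ?_, ?_, ?_, by simp⟩
    · rw [e₂, hX₁₂.1, hX₁₂.2]; ring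
    · rw [e₄, hX₁₄.1, hX₁₄.2]; ring
    · rw [e₁, hX₂₁.1, hX₂₁.2]; ring
    · rw [e₄, hX₂₄.1, hX₂₄.2]; ring
    · rw [e₁, hX₄₁.1, hX₄₁.2]; ring
    · rw [e₂, hX₄₂.1, hX₄₂.2]; ring

theorem exists_eq_smul_add_smul {u v m : Fin 3 → ℂ} (h : LinearIndependent ℂ ![u, v])
    (hm : m ⬝ᵥ crossProduct u v = 0) : ∃ a b : ℂ, m = a • u + b • v := by
  rw [triple_product_eq_det] at hm
  obtain ⟨t, ht, htm⟩ := Matrix.exists_vecMul_eq_zero_iff.2 hm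
  have hsum : t 0 • m + t 1 • u + t 2 • v = 0 := by
    rw [← htm]
    ext i
    simp [vecMul, dotProduct, Fin.sum_univ_three]
  have ht0 : t 0 ≠ 0 := by
    intro h0
    rw [h0, zero_smul, zero_add] at hsum
    obtain ⟨h1, h2⟩ := LinearIndependent.pair_iff.1 h _ _ hsum
    exact ht (by ext i; fin_cases i <;> simpa)
  refine ⟨-(t 1 / t 0), -(t 2 / t 0), ?_⟩
  apply smul_right_injective _ ht0
  simp only
  rw [smul_add, smul_smul, smul_smul, mul_neg, mul_neg, mul_div_cancel₀ _ ht0,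
    mul_div_cancel₀ _ ht0, neg_smul, neg_smul, ← sub_eq_zero, ← hsum]
  abel

/-! ### Coordinates adapted to three points of a conic -/

/-- The point `P` is `(b (1 + b) : 1 + b : -b)` in the coordinates `x`, `y`, `z`; such points lie
on the conic `xy + yz + zx = 0`. -/
structure IsConicParam (x y z : Poly3) (P : ProjPlane) (b : ℂ) : Prop where
  ne_zero : b ≠ 0
  one_add_ne_zero : 1 + b ≠ 0
  eval_y : eval P.rep x = b * eval P.rep y
  eval_z : eval P.rep x = -(1 + b) * eval P.rep z

theorem exists_isConicParam {x y z : Poly3} {P : ProjPlane} (hx : ¬ VanishesAt x P)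
    (hy : ¬ VanishesAt y P) (hz : ¬ VanishesAt z P)
    (hP : VanishesAt (x * y + y * z + z * x) P) : ∃ b, IsConicParam x y z P b := by
  simp only [VanishesAt, map_add, map_mul] at hx hy hz hP
  have h : 1 + eval P.rep x / eval P.rep y = -eval P.rep x / eval P.rep z := by
    field_simp
    linear_combination hP
  refine ⟨eval P.rep x / eval P.rep y, div_ne_zero hx hy, ?_, ?_, ?_⟩
  · rw [h]
    exact div_ne_zero (neg_ne_zero.2 hx) hz
  · field_simp
  · rw [h]
    field_simp

/-- The restriction of a quadratic form to the combinations of three of its zeros. -/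
theorem exists_polar {K : Poly3} (hK : K.IsHomogeneous 2) {a c e : Fin 3 → ℂ}
    (ha : eval a K = 0) (hc : eval c K = 0) (he : eval e K = 0) :
    ∃ β₁ β₂ β₃ : ℂ, ∀ s t u : ℂ,
      eval (s • a + t • c + u • e) K = t * u * β₁ + s * u * β₂ + s * t * β₃ := by
  have hform : ∀ F ∈ homogeneousSubmodule (Fin 3) ℂ 2,
      ∃ β₁ β₂ β₃ : ℂ, ∀ s t u : ℂ, eval (s • a + t • c + u • e) F =
        s ^ 2 * eval a F + t ^ 2 * eval c F + u ^ 2 * eval e F +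
          (t * u * β₁ + s * u * β₂ + s * t * β₃) := by
    intro F hF
    rw [← homogeneousSubmodule_one_pow, pow_two] at hF
    induction hF using Submodule.mul_induction_on' with
    | mem_mul_mem l hl m hm =>
      obtain ⟨v, hv⟩ := exists_eval_eq_dotProduct hl
      obtain ⟨w, hw⟩ := exists_eval_eq_dotProduct hm
      refine ⟨v ⬝ᵥ c * w ⬝ᵥ e + v ⬝ᵥ e * w ⬝ᵥ c, v ⬝ᵥ a * w ⬝ᵥ e + v ⬝ᵥ e * w ⬝ᵥ a,
        v ⬝ᵥ a * w ⬝ᵥ c + v ⬝ᵥ c * w ⬝ᵥ a, fun s t u => ?_⟩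
      simp only [map_mul, hv, hw, dotProduct_add, dotProduct_smul, smul_eq_mul]
      ring
    | add F _ G _ hF hG =>
      obtain ⟨β₁, β₂, β₃, hβ⟩ := hF
      obtain ⟨γ₁, γ₂, γ₃, hγ⟩ := hG
      refine ⟨β₁ + γ₁, β₂ + γ₂, β₃ + γ₃, fun s t u => ?_⟩
      simp only [map_add, hβ, hγ]
      ring
  obtain ⟨β₁, β₂, β₃, hβ⟩ := hform K hK
  exact ⟨β₁, β₂, β₃, fun s t u => by rw [hβ, ha, hc, he]; ring⟩

/-- A linear form vanishing at three noncollinear points is zero. -/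
theorem eq_zero_of_not_collin {L : Poly3} {P Q R : ProjPlane} (hL : L.IsHomogeneous 1)
    (hn : ¬ Collin {P, Q, R}) (hP : VanishesAt L P) (hQ : VanishesAt L Q)
    (hR : VanishesAt L R) : L = 0 := by
  by_contra h0
  exact (IsLineThrough.not_vanishesAt ⟨h0, hL, hP, hQ⟩ hn) hR

/-- Scaling the equations of the sides of a triangle inscribed in a conic `K` gives coordinates in
which the conic is `xy + yz + zx = 0`. -/
theorem exists_conic_coordinates {A C' E B D : ProjPlane} {K x y z : Poly3}
    (hK : K.IsHomogeneous 2) (hK0 : K ≠ 0)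
    (hKA : VanishesAt K A) (hKC : VanishesAt K C') (hKE : VanishesAt K E)
    (hKB : VanishesAt K B) (hKD : VanishesAt K D)
    (hx : IsLineThrough x C' E) (hy : IsLineThrough y A E) (hz : IsLineThrough z A C')
    (hACE : ¬ Collin {A, C', E}) (hABD : ¬ Collin {A, B, D}) (hCBD : ¬ Collin {C', B, D})
    (hEBD : ¬ Collin {E, B, D})
    (hxB : ¬ VanishesAt x B) (hyB : ¬ VanishesAt y B) (hzB : ¬ VanishesAt z B)
    (hxD : ¬ VanishesAt x D) (hyD : ¬ VanishesAt y D) (hzD : ¬ VanishesAt z D) :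
    ∃ k₁ k₂ k₃ : ℂ, k₁ ≠ 0 ∧ k₂ ≠ 0 ∧ k₃ ≠ 0 ∧ ∀ P, VanishesAt K P →
      VanishesAt ((C k₁ * x) * (C k₂ * y) + (C k₂ * y) * (C k₃ * z) +
        (C k₃ * z) * (C k₁ * x)) P := by
  have hxA : eval A.rep x ≠ 0 := hx.not_vanishesAt (by
    rwa [show ({C', E, A} : Set ProjPlane) = {A, C', E} by ext; simp; tauto])
  have hyC : eval C'.rep y ≠ 0 := hy.not_vanishesAt (by
    rwa [show ({A, E, C'} : Set ProjPlane) = {A, C', E} by ext; simp; tauto])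
  have hzE : eval E.rep z ≠ 0 := hz.not_vanishesAt hACE
  obtain ⟨-, hxh, hxC, hxE⟩ := hx
  obtain ⟨-, hyh, hyA, hyE⟩ := hy
  obtain ⟨-, hzh, hzA, hzC⟩ := hz
  obtain ⟨β₁, β₂, β₃, hβ⟩ := exists_polar hK hKA hKC hKE
  have hdecomp : ∀ v, v = (eval v x / eval A.rep x) • A.rep + (eval v y / eval C'.rep y) • C'.rep +
      (eval v z / eval E.rep z) • E.rep := by
    obtain ⟨wx, hwx⟩ := exists_eval_eq_dotProduct hxh
    obtain ⟨wy, hwy⟩ := exists_eval_eq_dotProduct hyh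
    obtain ⟨wz, hwz⟩ := exists_eval_eq_dotProduct hzh
    simp only [VanishesAt, hwx, hwy, hwz] at hxA hyC hzE hxC hxE hyA hyE hzA hzC ⊢
    have hli : LinearIndependent ℂ ![A.rep, C'.rep, E.rep] := by
      rw [Fintype.linearIndependent_iff]
      intro g hg
      simp only [Fin.sum_univ_three, cons_val_zero, cons_val_one, cons_val_two, head_cons,
        tail_cons] at hg
      have h₁ := congrArg (wx ⬝ᵥ ·) hg
      have h₂ := congrArg (wy ⬝ᵥ ·) hg
      have h₃ := congrArg (wz ⬝ᵥ ·) hg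
      simp [hxC, hxE, hyA, hyE, hzA, hzC, hxA, hyC, hzE] at h₁ h₂ h₃
      intro i
      fin_cases i <;> simpa
    intro v
    have hv : v ∈ Submodule.span ℂ (Set.range ![A.rep, C'.rep, E.rep]) := by
      rw [hli.span_eq_top_of_card_eq_finrank' (by simp)]
      trivial
    obtain ⟨g, rfl⟩ := (Submodule.mem_span_range_iff_exists_fun ℂ).1 hv
    simp [Fin.sum_univ_three, hxC, hxE, hyA, hyE, hzA, hzC, hxA, hyC, hzE]
  have hKv : ∀ v, eval v K =
      (eval v y / eval C'.rep y) * (eval v z / eval E.rep z) * β₁ +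
      (eval v x / eval A.rep x) * (eval v z / eval E.rep z) * β₂ +
      (eval v x / eval A.rep x) * (eval v y / eval C'.rep y) * β₃ := fun v => by
    conv_lhs => rw [hdecomp v]
    rw [hβ]
  have hβ0 : ¬ (β₁ = 0 ∧ β₂ = 0 ∧ β₃ = 0) := by
    rintro ⟨rfl, rfl, rfl⟩
    exact hK0 (MvPolynomial.funext fun v => by simp [hKv])
  simp only [VanishesAt] at hxC hxE hyA hyE hzA hzC hxB hyB hzB hxD hyD hzD hKB hKD
  rw [hKv] at hKB hKD
  have h₁ : β₁ ≠ 0 := by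
    rintro rfl
    have hL : C (β₂ / eval E.rep z) * z + C (β₃ / eval C'.rep y) * y = 0 := by
      refine eq_zero_of_not_collin ((hzh.C_mul _).add (hyh.C_mul _)) hABD ?_ ?_ ?_
      · simp [VanishesAt, hzA, hyA]
      · simp only [VanishesAt, map_add, map_mul, eval_C]
        apply (mul_eq_zero.1 _).resolve_left (div_ne_zero hxB hxA)
        linear_combination hKB
      · simp only [VanishesAt, map_add, map_mul, eval_C]
        apply (mul_eq_zero.1 _).resolve_left (div_ne_zero hxD hxA)
        linear_combination hKD
    have e₁ := congrArg (eval C'.rep) hL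
    have e₂ := congrArg (eval E.rep) hL
    simp [hzC, hyE, hyC, hzE] at e₁ e₂
    exact hβ0 ⟨rfl, e₂, e₁⟩
  have h₂ : β₂ ≠ 0 := by
    rintro rfl
    have hL : C (β₁ / eval E.rep z) * z + C (β₃ / eval A.rep x) * x = 0 := by
      refine eq_zero_of_not_collin ((hzh.C_mul _).add (hxh.C_mul _)) hCBD ?_ ?_ ?_
      · simp [VanishesAt, hzC, hxC]
      · simp only [VanishesAt, map_add, map_mul, eval_C]
        apply (mul_eq_zero.1 _).resolve_left (div_ne_zero hyB hyC)
        linear_combination hKB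
      · simp only [VanishesAt, map_add, map_mul, eval_C]
        apply (mul_eq_zero.1 _).resolve_left (div_ne_zero hyD hyC)
        linear_combination hKD
    have e₁ := congrArg (eval A.rep) hL
    have e₂ := congrArg (eval E.rep) hL
    simp [hzA, hxE, hxA, hzE] at e₁ e₂
    exact hβ0 ⟨e₂, rfl, e₁⟩
  have h₃ : β₃ ≠ 0 := by
    rintro rfl
    have hL : C (β₁ / eval C'.rep y) * y + C (β₂ / eval A.rep x) * x = 0 := by
      refine eq_zero_of_not_collin ((hyh.C_mul _).add (hxh.C_mul _)) hEBD ?_ ?_ ?_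
      · simp [VanishesAt, hyE, hxE]
      · simp only [VanishesAt, map_add, map_mul, eval_C]
        apply (mul_eq_zero.1 _).resolve_left (div_ne_zero hzB hzE)
        linear_combination hKB
      · simp only [VanishesAt, map_add, map_mul, eval_C]
        apply (mul_eq_zero.1 _).resolve_left (div_ne_zero hzD hzE)
        linear_combination hKD
    have e₁ := congrArg (eval A.rep) hL
    have e₂ := congrArg (eval C'.rep) hL
    simp [hyA, hxC, hxA, hyC] at e₁ e₂
    exact hβ0 ⟨e₂, e₁, rfl⟩
  refine ⟨1 / (eval A.rep x * β₁), 1 / (eval C'.rep y * β₂), 1 / (eval E.rep z * β₃),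
    one_div_ne_zero (mul_ne_zero hxA h₁), one_div_ne_zero (mul_ne_zero hyC h₂),
    one_div_ne_zero (mul_ne_zero hzE h₃), fun P hP => ?_⟩
  rw [VanishesAt, hKv] at hP
  simp only [VanishesAt, map_add, map_mul, eval_C]
  field_simp at hP ⊢
  linear_combination hP

/-- The line joining `A` to the point with parameter `b`. -/
def lineA (y z : Poly3) (b : ℂ) : Poly3 := C b * y + C (1 + b) * z

/-- The line joining `C` to the point with parameter `b`. -/
def lineC (x z : Poly3) (b : ℂ) : Poly3 := -(x + C (1 + b) * z)

/-- The line joining `E` to the point with parameter `b`. -/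
def lineE (x y : Poly3) (b : ℂ) : Poly3 := x - C b * y

/-- The line joining the points with parameters `b` and `d`. -/
def chord (x y z : Poly3) (b d : ℂ) : Poly3 :=
  -(x + C (b * d) * y + C ((1 + b) * (1 + d)) * z)

theorem isLineThrough_lineA {x y z : Poly3} {A E P : ProjPlane} {b : ℂ}
    (hy : IsLineThrough y A E) (hz : z.IsHomogeneous 1) (hzA : VanishesAt z A)
    (hzE : ¬ VanishesAt z E) (hP : IsConicParam x y z P b) : IsLineThrough (lineA y z b) A P := by
  obtain ⟨-, hy, hyA, hyE⟩ := hy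
  simp only [VanishesAt] at *
  refine ⟨fun h => ?_, (hy.C_mul b).add (hz.C_mul _), ?_, ?_⟩
  · have := congrArg (eval E.rep) h
    simp [lineA, hyE, hP.one_add_ne_zero, hzE] at this
  · simp [VanishesAt, lineA, hyA, hzA]
  · simp only [VanishesAt, lineA, map_add, map_mul, eval_C]
    linear_combination hP.eval_z - hP.eval_y

theorem isLineThrough_lineC {x y z : Poly3} {C' E P : ProjPlane} {b : ℂ}
    (hx : IsLineThrough x C' E) (hz : z.IsHomogeneous 1) (hzC : VanishesAt z C')
    (hzE : ¬ VanishesAt z E) (hP : IsConicParam x y z P b) :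
    IsLineThrough (lineC x z b) C' P := by
  obtain ⟨-, hx, hxC, hxE⟩ := hx
  simp only [VanishesAt] at *
  refine ⟨fun h => ?_, (hx.add (hz.C_mul _)).neg, ?_, ?_⟩
  · have := congrArg (eval E.rep) h
    simp [lineC, hxE, hP.one_add_ne_zero, hzE] at this
  · simp [VanishesAt, lineC, hxC, hzC]
  · simp only [VanishesAt, lineC, map_neg, map_add, map_mul, eval_C]
    linear_combination -hP.eval_z

theorem isLineThrough_lineE {x y z : Poly3} {C' E P : ProjPlane} {b : ℂ}
    (hx : IsLineThrough x C' E) (hy : y.IsHomogeneous 1) (hyE : VanishesAt y E)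
    (hyC : ¬ VanishesAt y C') (hP : IsConicParam x y z P b) :
    IsLineThrough (lineE x y b) E P := by
  obtain ⟨-, hx, hxC, hxE⟩ := hx
  simp only [VanishesAt] at *
  refine ⟨fun h => ?_, hx.sub (hy.C_mul _), ?_, ?_⟩
  · have := congrArg (eval C'.rep) h
    simp [lineE, hxC, hP.ne_zero, hyC] at this
  · simp [VanishesAt, lineE, hxE, hyE]
  · simp only [VanishesAt, lineE, map_sub, map_mul, eval_C]
    linear_combination hP.eval_y

theorem isLineThrough_chord {x y z : Poly3} {A P Q : ProjPlane} {b d : ℂ}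
    (hx : x.IsHomogeneous 1) (hy : y.IsHomogeneous 1) (hz : z.IsHomogeneous 1)
    (hxA : ¬ VanishesAt x A) (hyA : VanishesAt y A) (hzA : VanishesAt z A)
    (hP : IsConicParam x y z P b) (hQ : IsConicParam x y z Q d) :
    IsLineThrough (chord x y z b d) P Q := by
  simp only [VanishesAt] at *
  refine ⟨fun h => ?_, ((hx.add (hy.C_mul _)).add (hz.C_mul _)).neg, ?_, ?_⟩
  · have := congrArg (eval A.rep) h
    simp [chord, hyA, hzA, hxA] at this
  · simp only [VanishesAt, chord, map_neg, map_add, map_mul, eval_C]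
    linear_combination d * hP.eval_y - (1 + d) * hP.eval_z
  · simp only [VanishesAt, chord, map_neg, map_add, map_mul, eval_C]
    linear_combination b * hQ.eval_y - (1 + b) * hQ.eval_z

/-- The linear form with coefficients `w` in the coordinates `x`, `y`, `z`. -/
def linForm (x y z : Poly3) (w : Fin 3 → ℂ) : Poly3 := C (w 0) * x + C (w 1) * y + C (w 2) * z

theorem isHomogeneous_linForm {x y z : Poly3} (hx : x.IsHomogeneous 1) (hy : y.IsHomogeneous 1)
    (hz : z.IsHomogeneous 1) (w : Fin 3 → ℂ) : (linForm x y z w).IsHomogeneous 1 :=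
  ((hx.C_mul _).add (hy.C_mul _)).add (hz.C_mul _)

theorem exists_linForm_eq_add {x y z p q : Poly3} {u v m : Fin 3 → ℂ} {c d : ℂ}
    (hc : c ≠ 0) (hd : d ≠ 0) (hp : p = C c * linForm x y z u) (hq : q = C d * linForm x y z v)
    (hp0 : p ≠ 0) (hq0 : q ≠ 0) (hpq : ¬ ProportionalTo p q)
    (hm : m ⬝ᵥ crossProduct u v = 0) : ∃ a b : ℂ, linForm x y z m = C a * p + C b * q := by
  have hli : LinearIndependent ℂ ![u, v] := by
    have hu : u ≠ 0 := by
      rintro rfl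
      exact hp0 (by simp [hp, linForm])
    rw [LinearIndependent.pair_iff' hu]
    rintro s rfl
    have hs : s ≠ 0 := by
      rintro rfl
      exact hq0 (by simp [hq, linForm])
    refine hpq ⟨d * s / c, div_ne_zero (mul_ne_zero hd hs) hc, ?_⟩
    rw [hp, hq, ← C_mul', ← mul_assoc, ← C_mul, div_mul_cancel₀ _ hc]
    simp only [linForm, Pi.smul_apply, smul_eq_mul, map_mul]
    ring
  obtain ⟨a, b, rfl⟩ := exists_eq_smul_add_smul hli hm
  refine ⟨a / c, b / d, ?_⟩
  rw [hp, hq, ← mul_assoc, ← mul_assoc, ← C_mul, ← C_mul, div_mul_cancel₀ _ hc,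
    div_mul_cancel₀ _ hd]
  simp only [linForm, Pi.smul_apply, Pi.add_apply, smul_eq_mul, map_add, map_mul]
  ring

/-- The intersections `pᵢ ∩ qᵢ` of the normalized Pascal lines lie on a common line, with
coefficients `m`. -/
theorem exists_dotProduct_cross_eq_zero (b d f : ℂ) :
    ∃ m : Fin 3 → ℂ, m ≠ 0 ∧
      m ⬝ᵥ crossProduct ![-b, -(b * d * f), -((1 + b) * (1 + d) * f)]
        ![-(1 + b), -(b * (1 + d) * f), -((1 + b) * (1 + d) * (1 + f))] = 0 ∧
      m ⬝ᵥ crossProduct ![-1, -(d * f), -((1 + b) * (1 + f))]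
        ![f, b * d * f, (1 + b) * d * (1 + f)] = 0 ∧
      m ⬝ᵥ crossProduct ![f - b, b * (d - f), (d - b) * (1 + f)]
        ![d - b, d * (b - f), (1 + b) * (d - f)] = 0 := by
  have hdet : (Matrix.of
      ![crossProduct ![-b, -(b * d * f), -((1 + b) * (1 + d) * f)]
          ![-(1 + b), -(b * (1 + d) * f), -((1 + b) * (1 + d) * (1 + f))],
        crossProduct ![-1, -(d * f), -((1 + b) * (1 + f))]
          ![f, b * d * f, (1 + b) * d * (1 + f)],
        crossProduct ![f - b, b * (d - f), (d - b) * (1 + f)]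
          ![d - b, d * (b - f), (1 + b) * (d - f)]]).det = 0 := by
    simp only [det_fin_three, cross_apply, of_apply, cons_val]
    ring
  obtain ⟨m, hm0, hm⟩ := Matrix.exists_mulVec_eq_zero_iff.2 hdet
  refine ⟨m, hm0, ?_, ?_, ?_⟩ <;> rw [dotProduct_comm]
  exacts [congrFun hm 0, congrFun hm 1, congrFun hm 2]

theorem linForm_ne_zero {x y z : Poly3} {A C' E : ProjPlane} (hx : IsLineThrough x C' E)
    (hy : IsLineThrough y A E) (hz : IsLineThrough z A C') (hxA : ¬ VanishesAt x A)
    (hyC : ¬ VanishesAt y C') (hzE : ¬ VanishesAt z E) {w : Fin 3 → ℂ} (hw : w ≠ 0) :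
    linForm x y z w ≠ 0 := by
  obtain ⟨-, -, hxC, hxE⟩ := hx
  obtain ⟨-, -, hyA, hyE⟩ := hy
  obtain ⟨-, -, hzA, hzC⟩ := hz
  simp only [VanishesAt] at *
  intro h
  have h₀ := congrArg (eval A.rep) h
  have h₁ := congrArg (eval C'.rep) h
  have h₂ := congrArg (eval E.rep) h
  simp [linForm, *] at h₀ h₁ h₂
  exact hw (by ext i; fin_cases i <;> simpa)

/-! ### The conic divides the difference of two normalized cubics -/

theorem normalized_cubic_sub_eq_p₁ (x y z : Poly3) (b d f : ℂ) :
    lineA y z b * chord x y z d f * x - z * lineE x y f * chord x y z b d =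
      linForm x y z ![-b, -(b * d * f), -((1 + b) * (1 + d) * f)] * (x * y + y * z + z * x) := by
  simp only [linForm, lineA, lineE, chord, Matrix.cons_val, map_add, map_mul, map_neg, map_one]
  ring

theorem normalized_cubic_sub_eq_p₂ (x y z : Poly3) (b d f : ℂ) :
    z * chord x y z b f * lineE x y d - y * lineC x z b * chord x y z d f =
      linForm x y z ![-1, -(d * f), -((1 + b) * (1 + f))] * (x * y + y * z + z * x) := by
  simp only [linForm, lineC, lineE, chord, Matrix.cons_val, map_add, map_mul, map_neg, map_one]
  ring

theorem normalized_cubic_sub_eq_p₄ (x y z : Poly3) (b d f : ℂ) :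
    lineA y z b * lineE x y d * lineC x z f - lineA y z f * lineE x y b * lineC x z d =
      linForm x y z ![f - b, b * (d - f), (d - b) * (1 + f)] * (x * y + y * z + z * x) := by
  simp only [linForm, lineA, lineC, lineE, Matrix.cons_val, map_add, map_sub, map_mul, map_one]
  ring

theorem normalized_cubic_sub_eq_q₁ (x y z : Poly3) (b d f : ℂ) :
    lineA y z b * chord x y z d f * x - y * chord x y z b f * lineC x z d =
      linForm x y z ![-(1 + b), -(b * (1 + d) * f), -((1 + b) * (1 + d) * (1 + f))] *
        (x * y + y * z + z * x) := by
  simp only [linForm, lineA, lineC, chord, Matrix.cons_val, map_add, map_mul, map_neg, map_one]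
  ring

theorem normalized_cubic_sub_eq_q₂ (x y z : Poly3) (b d f : ℂ) :
    z * chord x y z b f * lineE x y d - lineA y z f * chord x y z b d * x =
      linForm x y z ![f, b * d * f, (1 + b) * d * (1 + f)] * (x * y + y * z + z * x) := by
  simp only [linForm, lineA, lineE, chord, Matrix.cons_val, map_add, map_mul, map_one]
  ring

theorem normalized_cubic_sub_eq_q₄ (x y z : Poly3) (b d f : ℂ) :
    lineA y z b * lineE x y d * lineC x z f - lineA y z d * lineC x z b * lineE x y f =
      linForm x y z ![d - b, d * (b - f), (1 + b) * (d - f)] * (x * y + y * z + z * x) := by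
  simp only [linForm, lineA, lineC, lineE, Matrix.cons_val, map_add, map_sub, map_mul, map_one]
  ring

/-- **The Steiner conic.** The six points `p₁ ∩ q₂`, `p₁ ∩ q₄`, `p₂ ∩ q₁`, `p₂ ∩ q₄`,
`p₄ ∩ q₁`, `p₄ ∩ q₂` lie on a common conic. -/
theorem steiner_conic (A B C D E F : ProjPlane)
    (hdist : ([A, B, C, D, E, F] : List ProjPlane).Pairwise (· ≠ ·))
    (K : Poly3) (hKh : K.IsHomogeneous 2) (hKirr : Irreducible K)
    (honK : ∀ p ∈ [A, B, C, D, E, F], VanishesAt K p)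
    (hn3 : NoThreeCollinear {A, B, C, D, E, F})
    (lAB lAC lAD lAE lAF lBC lBD lBE lBF lCD lCE lCF lDE lDF lEF : Poly3)
    (hlAB : IsLineThrough lAB A B) (hlAC : IsLineThrough lAC A C)
    (hlAD : IsLineThrough lAD A D) (hlAE : IsLineThrough lAE A E)
    (hlAF : IsLineThrough lAF A F) (hlBC : IsLineThrough lBC B C)
    (hlBD : IsLineThrough lBD B D) (hlBE : IsLineThrough lBE B E)
    (hlBF : IsLineThrough lBF B F) (hlCD : IsLineThrough lCD C D)
    (hlCE : IsLineThrough lCE C E) (hlCF : IsLineThrough lCF C F)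
    (hlDE : IsLineThrough lDE D E) (hlDF : IsLineThrough lDF D F)
    (hlEF : IsLineThrough lEF E F)
    (p₁ p₂ p₄ q₁ q₂ q₄ : Poly3)
    (hp₁ : IsGenPascalLine A B C D E F (lAB * lDF * lCE) (lAC * lEF * lBD) p₁)
    (hp₂ : IsGenPascalLine A B C D E F (lAC * lBF * lDE) (lAE * lBC * lDF) p₂)
    (hp₄ : IsGenPascalLine A B C D E F (lAB * lDE * lCF) (lAF * lBE * lCD) p₄)
    (hq₁ : IsGenPascalLine A B C D E F (lAB * lDF * lCE) (lAE * lBF * lCD) q₁)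
    (hq₂ : IsGenPascalLine A B C D E F (lAC * lBF * lDE) (lAF * lBD * lCE) q₂)
    (hq₄ : IsGenPascalLine A B C D E F (lAB * lDE * lCF) (lAD * lBC * lEF) q₄)
    (hne : ∀ i j : Fin 3, ¬ ProportionalTo (![p₁, p₂, p₄] i) (![q₁, q₂, q₄] j))
    (X₁₂ X₁₄ X₂₁ X₂₄ X₄₁ X₄₂ : ProjPlane)
    (hX₁₂ : VanishesAt p₁ X₁₂ ∧ VanishesAt q₂ X₁₂)
    (hX₁₄ : VanishesAt p₁ X₁₄ ∧ VanishesAt q₄ X₁₄)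
    (hX₂₁ : VanishesAt p₂ X₂₁ ∧ VanishesAt q₁ X₂₁)
    (hX₂₄ : VanishesAt p₂ X₂₄ ∧ VanishesAt q₄ X₂₄)
    (hX₄₁ : VanishesAt p₄ X₄₁ ∧ VanishesAt q₁ X₄₁)
    (hX₄₂ : VanishesAt p₄ X₄₂ ∧ VanishesAt q₂ X₄₂) :
    ∃ S : Poly3, S ≠ 0 ∧ S.IsHomogeneous 2 ∧
      ∀ p ∈ [X₁₂, X₁₄, X₂₁, X₂₄, X₄₁, X₄₂], VanishesAt S p := by
  have hK0 := hKirr.ne_zero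
  simp only [List.pairwise_cons, List.mem_cons, List.not_mem_nil, or_false, forall_eq_or_imp,
    forall_eq, IsEmpty.forall_iff, implies_true, List.Pairwise.nil, and_true] at hdist honK
  obtain ⟨⟨nAB, nAC, nAD, nAE, nAF⟩, ⟨nBC, nBD, nBE, nBF⟩, ⟨nCD, nCE, nCF⟩, ⟨nDE, nDF⟩, nEF⟩ :=
    hdist
  obtain ⟨kA, kB, kC, kD, kE, kF⟩ := honK
  have hn : ∀ {P Q R : ProjPlane}, P ∈ ({A, B, C, D, E, F} : Set ProjPlane) →
      Q ∈ ({A, B, C, D, E, F} : Set ProjPlane) → R ∈ ({A, B, C, D, E, F} : Set ProjPlane) →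
      P ≠ Q → P ≠ R → Q ≠ R → ¬ Collin {P, Q, R} := hn3 _ _ _
  have mA : A ∈ ({A, B, C, D, E, F} : Set ProjPlane) := by simp
  have mB : B ∈ ({A, B, C, D, E, F} : Set ProjPlane) := by simp
  have mC : C ∈ ({A, B, C, D, E, F} : Set ProjPlane) := by simp
  have mD : D ∈ ({A, B, C, D, E, F} : Set ProjPlane) := by simp
  have mE : E ∈ ({A, B, C, D, E, F} : Set ProjPlane) := by simp
  have mF : F ∈ ({A, B, C, D, E, F} : Set ProjPlane) := by simp
  obtain ⟨x, y, z, hx, hy, hz, hQ⟩ : ∃ x y z : Poly3, IsLineThrough x C E ∧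
      IsLineThrough y A E ∧ IsLineThrough z A C ∧
      ∀ P, VanishesAt K P → VanishesAt (x * y + y * z + z * x) P := by
    obtain ⟨k₁, k₂, k₃, hk₁, hk₂, hk₃, hQ⟩ := exists_conic_coordinates hKh hK0 kA kC kE kB kD
      hlCE hlAE hlAC
      (hn mA mC mE nAC nAE nCE)
      (hn mA mB mD nAB nAD nBD)
      (hn mC mB mD nBC.symm nCD nBD)
      (hn mE mB mD nBE.symm nDE.symm nBD)
      (hlCE.not_vanishesAt (hn mC mE mB nCE nBC.symm nBE.symm))
      (hlAE.not_vanishesAt (hn mA mE mB nAE nAB nBE.symm))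
      (hlAC.not_vanishesAt (hn mA mC mB nAC nAB nBC.symm))
      (hlCE.not_vanishesAt (hn mC mE mD nCE nCD nDE.symm))
      (hlAE.not_vanishesAt (hn mA mE mD nAE nAD nDE.symm))
      (hlAC.not_vanishesAt (hn mA mC mD nAC nAD nCD))
    exact ⟨_, _, _, hlCE.C_mul hk₁, hlAE.C_mul hk₂, hlAC.C_mul hk₃, hQ⟩
  obtain ⟨b, hB⟩ := exists_isConicParam (hx.not_vanishesAt (hn mC mE mB nCE nBC.symm nBE.symm))
    (hy.not_vanishesAt (hn mA mE mB nAE nAB nBE.symm))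
    (hz.not_vanishesAt (hn mA mC mB nAC nAB nBC.symm)) (hQ _ kB)
  obtain ⟨d, hD⟩ := exists_isConicParam (hx.not_vanishesAt (hn mC mE mD nCE nCD nDE.symm))
    (hy.not_vanishesAt (hn mA mE mD nAE nAD nDE.symm))
    (hz.not_vanishesAt (hn mA mC mD nAC nAD nCD)) (hQ _ kD)
  obtain ⟨f, hF⟩ := exists_isConicParam (hx.not_vanishesAt (hn mC mE mF nCE nCF nEF))
    (hy.not_vanishesAt (hn mA mE mF nAE nAF nEF))
    (hz.not_vanishesAt (hn mA mC mF nAC nAF nCF)) (hQ _ kF)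
  have hxA := hx.not_vanishesAt (hn mC mE mA nCE nAC.symm nAE.symm)
  have hyC := hy.not_vanishesAt (hn mA mE mC nAE nAC nCE.symm)
  have hzE := hz.not_vanishesAt (hn mA mC mE nAC nAE nCE)
  have hxh := hx.2.1
  have hyh := hy.2.1
  have hzh := hz.2.1
  have gAB := isLineThrough_lineA hy hzh hz.2.2.1 hzE hB
  have gAD := isLineThrough_lineA hy hzh hz.2.2.1 hzE hD
  have gAF := isLineThrough_lineA hy hzh hz.2.2.1 hzE hF
  have gBC := (isLineThrough_lineC hx hzh hz.2.2.2 hzE hB).symm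
  have gBD := isLineThrough_chord hxh hyh hzh hxA hy.2.2.1 hz.2.2.1 hB hD
  have gBE := (isLineThrough_lineE hx hyh hy.2.2.2 hyC hB).symm
  have gBF := isLineThrough_chord hxh hyh hzh hxA hy.2.2.1 hz.2.2.1 hB hF
  have gCD := isLineThrough_lineC hx hzh hz.2.2.2 hzE hD
  have gCF := isLineThrough_lineC hx hzh hz.2.2.2 hzE hF
  have gDE := (isLineThrough_lineE hx hyh hy.2.2.2 hyC hD).symm
  have gDF := isLineThrough_chord hxh hyh hzh hxA hy.2.2.1 hz.2.2.1 hD hF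
  have gEF := isLineThrough_lineE hx hyh hy.2.2.2 hyC hF
  obtain ⟨cAB, zAB, eAB⟩ := hlAB.exists_eq_C_mul gAB nAB
  obtain ⟨cAC, zAC, eAC⟩ := hlAC.exists_eq_C_mul hz nAC
  obtain ⟨cAD, zAD, eAD⟩ := hlAD.exists_eq_C_mul gAD nAD
  obtain ⟨cAE, zAE, eAE⟩ := hlAE.exists_eq_C_mul hy nAE
  obtain ⟨cAF, zAF, eAF⟩ := hlAF.exists_eq_C_mul gAF nAF
  obtain ⟨cBC, zBC, eBC⟩ := hlBC.exists_eq_C_mul gBC nBC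
  obtain ⟨cBD, zBD, eBD⟩ := hlBD.exists_eq_C_mul gBD nBD
  obtain ⟨cBE, zBE, eBE⟩ := hlBE.exists_eq_C_mul gBE nBE
  obtain ⟨cBF, zBF, eBF⟩ := hlBF.exists_eq_C_mul gBF nBF
  obtain ⟨cCD, zCD, eCD⟩ := hlCD.exists_eq_C_mul gCD nCD
  obtain ⟨cCE, zCE, eCE⟩ := hlCE.exists_eq_C_mul hx nCE
  obtain ⟨cCF, zCF, eCF⟩ := hlCF.exists_eq_C_mul gCF nCF
  obtain ⟨cDE, zDE, eDE⟩ := hlDE.exists_eq_C_mul gDE nDE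
  obtain ⟨cDF, zDF, eDF⟩ := hlDF.exists_eq_C_mul gDF nDF
  obtain ⟨cEF, zEF, eEF⟩ := hlEF.exists_eq_C_mul gEF nEF
  have iAB : ∀ P, VanishesAt (lineA y z b) P → VanishesAt (x * y + y * z + z * x) P →
      P = A ∨ P = B :=
    fun P => gAB.eq_or_eq_of_conic (c := b) (s := 1) (r := x + z) hz gBC
      (hn mA mB mC nAB nAC nBC) one_ne_zero (by
        simp only [lineA, lineC, map_add, map_one]
        ring)
  have iAC : ∀ P, VanishesAt z P → VanishesAt (x * y + y * z + z * x) P →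
      P = A ∨ P = C :=
    fun P => hz.eq_or_eq_of_conic (c := 1) (s := 1) (r := x + y) hy hx
      (hn mA mC mE nAC nAE nCE) one_ne_zero (by
        simp only [map_one]
        ring)
  have iCE : ∀ P, VanishesAt x P → VanishesAt (x * y + y * z + z * x) P →
      P = C ∨ P = E :=
    fun P => hx.eq_or_eq_of_conic (c := 1) (s := 1) (r := y + z) hz.symm hy.symm
      (hn mC mE mA nCE nAC.symm nAE.symm) one_ne_zero (by
        simp only [map_one]
        ring)
  have iBF : ∀ P, VanishesAt (chord x y z b f) P → VanishesAt (x * y + y * z + z * x) P →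
      P = B ∨ P = F :=
    fun P => gBF.eq_or_eq_of_conic (c := 1) (s := -1) (r := -(y + z)) gAB.symm gAF.symm
      (hn mB mF mA nBF nAB.symm nAF.symm) (neg_ne_zero.2 one_ne_zero) (by
        simp only [lineA, chord, map_add, map_mul, map_neg, map_one]
        ring)
  have iDF : ∀ P, VanishesAt (chord x y z d f) P → VanishesAt (x * y + y * z + z * x) P →
      P = D ∨ P = F :=
    fun P => gDF.eq_or_eq_of_conic (c := 1) (s := -1) (r := -(y + z)) gAD.symm gAF.symm
      (hn mD mF mA nDF nAD.symm nAF.symm) (neg_ne_zero.2 one_ne_zero) (by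
        simp only [lineA, chord, map_add, map_mul, map_neg, map_one]
        ring)
  have iDE : ∀ P, VanishesAt (lineE x y d) P → VanishesAt (x * y + y * z + z * x) P →
      P = D ∨ P = E :=
    fun P => gDE.eq_or_eq_of_conic (c := 1) (s := 1) (r := y + z) gAD.symm hy.symm
      (hn mD mE mA nDE nAD.symm nAE.symm) one_ne_zero (by
        simp only [lineA, lineE, map_add, map_one]
        ring)
  have iCF : ∀ P, VanishesAt (lineC x z f) P → VanishesAt (x * y + y * z + z * x) P →
      P = C ∨ P = F :=
    fun P => gCF.eq_or_eq_of_conic (c := 1) (s := -1) (r := -(y + z)) hz.symm gAF.symm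
      (hn mC mF mA nCF nAC.symm nAF.symm) (neg_ne_zero.2 one_ne_zero) (by
        simp only [lineA, lineC, map_add, map_neg, map_one]
        ring)
  have hM₁ : ∀ P, VanishesAt (lineA y z b * chord x y z d f * x) P →
      VanishesAt (x * y + y * z + z * x) P → P = A ∨ P = B ∨ P = C ∨ P = D ∨ P = E ∨ P = F := by
    intro P hP hQP
    rw [vanishesAt_mul, vanishesAt_mul] at hP
    rcases hP with (h | h) | h
    · obtain e | e := iAB P h hQP <;> simp [e]
    · obtain e | e := iDF P h hQP <;> simp [e]
    · obtain e | e := iCE P h hQP <;> simp [e]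
  have hM₂ : ∀ P, VanishesAt (z * chord x y z b f * lineE x y d) P →
      VanishesAt (x * y + y * z + z * x) P → P = A ∨ P = B ∨ P = C ∨ P = D ∨ P = E ∨ P = F := by
    intro P hP hQP
    rw [vanishesAt_mul, vanishesAt_mul] at hP
    rcases hP with (h | h) | h
    · obtain e | e := iAC P h hQP <;> simp [e]
    · obtain e | e := iBF P h hQP <;> simp [e]
    · obtain e | e := iDE P h hQP <;> simp [e]
  have hM₄ : ∀ P, VanishesAt (lineA y z b * lineE x y d * lineC x z f) P →
      VanishesAt (x * y + y * z + z * x) P → P = A ∨ P = B ∨ P = C ∨ P = D ∨ P = E ∨ P = F := by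
    intro P hP hQP
    rw [vanishesAt_mul, vanishesAt_mul] at hP
    rcases hP with (h | h) | h
    · obtain e | e := iAB P h hQP <;> simp [e]
    · obtain e | e := iDE P h hQP <;> simp [e]
    · obtain e | e := iCF P h hQP <;> simp [e]
  obtain ⟨cp₁, zp₁, ep₁⟩ := hp₁.exists_eq_C_mul
    (mul_ne_zero (mul_ne_zero zAB zDF) zCE)
    (mul_ne_zero (mul_ne_zero zAC zEF) zBD)
    (by rw [eAB, eDF, eCE, C_mul, C_mul]
        ring)
    (by rw [eAC, eEF, eBD, C_mul, C_mul]
        ring)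
    (isHomogeneous_linForm hxh hyh hzh _) (normalized_cubic_sub_eq_p₁ x y z b d f) hM₁
  obtain ⟨cp₂, zp₂, ep₂⟩ := hp₂.exists_eq_C_mul
    (mul_ne_zero (mul_ne_zero zAC zBF) zDE)
    (mul_ne_zero (mul_ne_zero zAE zBC) zDF)
    (by rw [eAC, eBF, eDE, C_mul, C_mul]
        ring)
    (by rw [eAE, eBC, eDF, C_mul, C_mul]
        ring)
    (isHomogeneous_linForm hxh hyh hzh _) (normalized_cubic_sub_eq_p₂ x y z b d f) hM₂
  obtain ⟨cp₄, zp₄, ep₄⟩ := hp₄.exists_eq_C_mul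
    (mul_ne_zero (mul_ne_zero zAB zDE) zCF)
    (mul_ne_zero (mul_ne_zero zAF zBE) zCD)
    (by rw [eAB, eDE, eCF, C_mul, C_mul]
        ring)
    (by rw [eAF, eBE, eCD, C_mul, C_mul]
        ring)
    (isHomogeneous_linForm hxh hyh hzh _) (normalized_cubic_sub_eq_p₄ x y z b d f) hM₄
  obtain ⟨cq₁, zq₁, eq₁⟩ := hq₁.exists_eq_C_mul
    (mul_ne_zero (mul_ne_zero zAB zDF) zCE)
    (mul_ne_zero (mul_ne_zero zAE zBF) zCD)
    (by rw [eAB, eDF, eCE, C_mul, C_mul]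
        ring)
    (by rw [eAE, eBF, eCD, C_mul, C_mul]
        ring)
    (isHomogeneous_linForm hxh hyh hzh _) (normalized_cubic_sub_eq_q₁ x y z b d f) hM₁
  obtain ⟨cq₂, zq₂, eq₂⟩ := hq₂.exists_eq_C_mul
    (mul_ne_zero (mul_ne_zero zAC zBF) zDE)
    (mul_ne_zero (mul_ne_zero zAF zBD) zCE)
    (by rw [eAC, eBF, eDE, C_mul, C_mul]
        ring)
    (by rw [eAF, eBD, eCE, C_mul, C_mul]
        ring)
    (isHomogeneous_linForm hxh hyh hzh _) (normalized_cubic_sub_eq_q₂ x y z b d f) hM₂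
  obtain ⟨cq₄, zq₄, eq₄⟩ := hq₄.exists_eq_C_mul
    (mul_ne_zero (mul_ne_zero zAB zDE) zCF)
    (mul_ne_zero (mul_ne_zero zAD zBC) zEF)
    (by rw [eAB, eDE, eCF, C_mul, C_mul]
        ring)
    (by rw [eAD, eBC, eEF, C_mul, C_mul]
        ring)
    (isHomogeneous_linForm hxh hyh hzh _) (normalized_cubic_sub_eq_q₄ x y z b d f) hM₄
  obtain ⟨m, hm0, hm₁, hm₂, hm₄⟩ := exists_dotProduct_cross_eq_zero b d f
  obtain ⟨a₁, b₁, h₁⟩ := exists_linForm_eq_add zp₁ zq₁ ep₁ eq₁ hp₁.2.1 hq₁.2.1 (hne 0 0) hm₁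
  obtain ⟨a₂, b₂, h₂⟩ := exists_linForm_eq_add zp₂ zq₂ ep₂ eq₂ hp₂.2.1 hq₂.2.1 (hne 1 1) hm₂
  obtain ⟨a₄, b₄, h₄⟩ := exists_linForm_eq_add zp₄ zq₄ ep₄ eq₄ hp₄.2.1 hq₄.2.1 (hne 2 2) hm₄
  exact exists_conic_of_eq_add hp₁.2.2.1 hp₂.2.2.1 hp₄.2.2.1 hq₁.2.2.1 hq₂.2.2.1 hq₄.2.2.1
    hp₁.2.1 hp₂.2.1 hp₄.2.1 hq₁.2.1 hq₂.2.1 hq₄.2.1 hne (isHomogeneous_linForm hxh hyh hzh m)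
    (linForm_ne_zero hx hy hz hxA hyC hzE hm0) h₁ h₂ h₄ hX₁₂ hX₁₄ hX₂₁ hX₂₄ hX₄₁ hX₄₂
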